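/- Let a : ℕ → ℝ be a sequence of distinct positive reals. Suppose there exist δ > 0 and ε₀ > 0 such that for every ε with 0 < ε < ε₀ the following two counting conditions hold (with constants allowed to depend on ε): (A) #{(n,x,y) ∈ ℤ³ : 1 ≤ n ≤ N^{1+ε}, 1 ≤ x, y ≤ N, x ≠ y, n·|a(x) − a(y)| < N^ε} ≪ N^{2−δ} for all N; (B) the number of integer six-tuples (n₁,n₂,x₁,y₁,x₂,y₂) with 1 ≤ |nᵢ| ≤ N^{1+ε}, 1 ≤ xᵢ, yᵢ ≤ N, xᵢ ≠ yᵢ (i = 1,2), satisfying |n₁(a(x₁) − a(y₁)) − n₂(a(x₂) − a(y₂))| < N^ε, is ≪ N^{4−δ} for all N. Then for Lebesgue almost every α ∈ ℝ, the pair correlation of α·a(x) is Poissonian: for every s > 0, lim_{N→∞} (1/N) · #{(m,n) : 1 ≤ m, n ≤ N, m ≠ n, ‖α·a(m) − α·a(n)‖ ≤ s/N} = 2s. -/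

import Mathlib

open MeasureTheory Filter

/-- The count of triples `(n,x,y)` with `1 ≤ n ≤ M` (an integer), `1 ≤ x ≠ y ≤ N`,
and `n·|a(x) − a(y)| < K`. -/
noncomputable def countA (a : ℕ → ℝ) (M K : ℝ) (N : ℕ) : ℕ :=
  Set.ncard {t : ℤ × ℕ × ℕ |
    1 ≤ t.1 ∧ (t.1 : ℝ) ≤ M ∧
    1 ≤ t.2.1 ∧ t.2.1 ≤ N ∧ 1 ≤ t.2.2 ∧ t.2.2 ≤ N ∧ t.2.1 ≠ t.2.2 ∧
    (t.1 : ℝ) * |a t.2.1 - a t.2.2| < K}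

/-- The count of six-tuples `(n₁,n₂,x₁,y₁,x₂,y₂)` with `1 ≤ |nᵢ| ≤ M`,
`1 ≤ xᵢ ≠ yᵢ ≤ N` and `|n₁(a(x₁) − a(y₁)) − n₂(a(x₂) − a(y₂))| < K`. -/
noncomputable def countB (a : ℕ → ℝ) (M K : ℝ) (N : ℕ) : ℕ :=
  Set.ncard {t : ℤ × ℤ × ℕ × ℕ × ℕ × ℕ |
    1 ≤ |t.1| ∧ (|t.1| : ℝ) ≤ M ∧
    1 ≤ |t.2.1| ∧ (|t.2.1| : ℝ) ≤ M ∧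
    1 ≤ t.2.2.1 ∧ t.2.2.1 ≤ N ∧ 1 ≤ t.2.2.2.1 ∧ t.2.2.2.1 ≤ N ∧ t.2.2.1 ≠ t.2.2.2.1 ∧
    1 ≤ t.2.2.2.2.1 ∧ t.2.2.2.2.1 ≤ N ∧ 1 ≤ t.2.2.2.2.2 ∧ t.2.2.2.2.2 ≤ N ∧
      t.2.2.2.2.1 ≠ t.2.2.2.2.2 ∧
    |(t.1 : ℝ) * (a t.2.2.1 - a t.2.2.2.1) - (t.2.1 : ℝ) * (a t.2.2.2.2.1 - a t.2.2.2.2.2)| < K}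

section

open ProbabilityTheory
open scoped FourierTransform SchwartzMap ComplexConjugate

/-- Fourier transform of a dilated function. -/
theorem fourier_comp_mul_left (f : ℝ → ℂ) {L : ℝ} (hL : 0 < L) (w : ℝ) :
    𝓕 (fun x => f (L * x)) w = ((L⁻¹ : ℝ) : ℂ) * 𝓕 f (w / L) := by
  rw [Real.fourier_real_eq_integral_exp_smul, Real.fourier_real_eq_integral_exp_smul]
  have h := Measure.integral_comp_mul_left
    (fun v : ℝ => Complex.exp (↑(-2 * Real.pi * v * (w / L)) * Complex.I) • f v) L
  rw [abs_of_pos (inv_pos.2 hL), Complex.real_smul] at h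
  rw [← h]
  refine integral_congr_ae (ae_of_all _ fun v => ?_)
  have : -2 * Real.pi * (L * v) * (w / L) = -2 * Real.pi * v * w := by
    field_simp
  simp only [this]

theorem hasSum_periodization (f : 𝓢(ℝ, ℂ)) {L : ℝ} (hL : 0 < L) (t : ℝ) :
    HasSum (fun n : ℤ => ((L⁻¹ : ℝ) : ℂ) * 𝓕 f (n / L) *
      Complex.exp (((2 * Real.pi * n * t : ℝ) : ℂ) * Complex.I)) (∑' k : ℤ, f (L * (t + k))) := by
  let g : 𝓢(ℝ, ℂ) := SchwartzMap.compCLMOfContinuousLinearEquiv ℂ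
    (ContinuousLinearEquiv.smulLeft (Units.mk0 L hL.ne')) f
  have hg : ∀ x, g x = f (L * x) := fun x => rfl
  have hFg : ∀ w : ℝ, 𝓕 g w = ((L⁻¹ : ℝ) : ℂ) * 𝓕 f (w / L) := fun w =>
    fourier_comp_mul_left f hL w
  have hexp : ∀ n : ℤ, (fourier n (t : UnitAddCircle) : ℂ) =
      Complex.exp (((2 * Real.pi * n * t : ℝ) : ℂ) * Complex.I) := fun n => by
    rw [fourier_coe_apply]
    congr 1
    push_cast
    ring
  have hsum : Summable fun n : ℤ => 𝓕 g n :=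
    summable_of_isBigO (Real.summable_abs_int_rpow one_lt_two)
      (((𝓕 g).isBigO_cocompact_rpow (-2)).comp_tendsto Int.tendsto_coe_cofinite)
  have hsum' : Summable fun n : ℤ => 𝓕 g n * fourier n (t : UnitAddCircle) := by
    refine Summable.of_norm ?_
    refine hsum.norm.congr fun n => ?_
    rw [norm_mul, hexp, Complex.norm_exp_ofReal_mul_I, mul_one]
  have h := hsum'.hasSum
  rw [← SchwartzMap.tsum_eq_tsum_fourier g t] at h
  simp only [hg, hexp, hFg] at h
  exact h

/-- Truncating the Fourier series of a periodised dilated Schwartz function at height `L ^ (1 + ε)`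
leaves an error which is smaller than any given power of `L`. -/
theorem exists_norm_periodization_sub_le (f : 𝓢(ℝ, ℂ)) {ε : ℝ} (hε : 0 < ε) :
    ∃ C : ℝ, ∀ L : ℝ, 1 ≤ L → ∀ (s : Finset ℤ),
      (∀ n : ℤ, |(n : ℝ)| ≤ L ^ (1 + ε) → n ∈ s) → ∀ t : ℝ,
      ‖(∑' k : ℤ, f (L * (t + k))) - ∑ n ∈ s, ((L⁻¹ : ℝ) : ℂ) * 𝓕 f (n / L) *
        Complex.exp (((2 * Real.pi * n * t : ℝ) : ℂ) * Complex.I)‖ ≤ C / L ^ 2 := by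
  obtain ⟨m, hm⟩ := exists_nat_ge (3 / ε)
  have hm' : 3 ≤ ε * m := by
    rw [div_le_iff₀ hε] at hm
    linarith
  obtain ⟨C, hC0, hC⟩ := (𝓕 f).decay (m + 2) 0
  simp only [norm_iteratedFDeriv_zero] at hC
  have hS : Summable fun n : ℤ => 1 / (n : ℝ) ^ 2 :=
    Real.summable_one_div_int_pow.2 one_lt_two
  refine ⟨C * ∑' n : ℤ, 1 / (n : ℝ) ^ 2, fun L hL s hs t => ?_⟩
  have hL0 : 0 < L := by linarith
  have hsum := hasSum_periodization f hL0 t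
  set F : ℤ → ℂ := fun n => ((L⁻¹ : ℝ) : ℂ) * 𝓕 f (n / L) *
        Complex.exp (((2 * Real.pi * n * t : ℝ) : ℂ) * Complex.I) with hF
  have hbound : ∀ n : ℤ, n ∉ s → ‖F n‖ ≤ C / L ^ 2 * (1 / (n : ℝ) ^ 2) := by
    intro n hn
    have hnL : L ^ (1 + ε) < |(n : ℝ)| := by
      by_contra hcon
      exact hn (hs n (not_lt.1 hcon))
    have hn0 : 0 < |(n : ℝ)| := lt_of_le_of_lt (by positivity) hnL
    have h1 := hC (n / L)
    rw [hF]
    simp only [norm_mul, Complex.norm_exp_ofReal_mul_I, mul_one, Complex.norm_real, norm_inv,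
      Real.norm_eq_abs, abs_of_pos hL0]
    rw [Real.norm_eq_abs, abs_div, abs_of_pos hL0] at h1
    have h2 : L ^ ε ≤ |(n : ℝ)| / L := by
      rw [le_div_iff₀ hL0, mul_comm]
      rw [Real.rpow_add hL0, Real.rpow_one] at hnL
      exact hnL.le
    have h3 : L ^ 3 ≤ (|(n : ℝ)| / L) ^ m := by
      calc L ^ 3 = L ^ (3 : ℝ) := by norm_cast
        _ ≤ L ^ (ε * m) := Real.rpow_le_rpow_of_exponent_le hL hm'
        _ = (L ^ ε) ^ m := by rw [Real.rpow_mul hL0.le, Real.rpow_natCast]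
        _ ≤ _ := by gcongr
    have h4 : L ^ 3 * (|(n : ℝ)| / L) ^ 2 * ‖𝓕 f (n / L)‖ ≤ C := by
      refine le_trans ?_ h1
      rw [pow_add]
      gcongr
    have h5 : L ^ 3 * (|(n : ℝ)| / L) ^ 2 = L * |(n : ℝ)| ^ 2 := by
      field_simp
    rw [h5] at h4
    rw [← sq_abs (n : ℝ), div_mul_div_comm, mul_one, le_div_iff₀ (by positivity)]
    have h6 : L⁻¹ * ‖𝓕 f (n / L)‖ * (L ^ 2 * |(n : ℝ)| ^ 2) =
        L * |(n : ℝ)| ^ 2 * ‖𝓕 f (n / L)‖ := by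
      field_simp
    rw [h6]
    exact h4
  have hdiff : HasSum (fun n : {n // n ∉ s} => F n)
      ((∑' k : ℤ, f (L * (t + k))) - ∑ n ∈ s, F n) := by
    rw [s.hasSum_compl_iff]
    simpa using hsum
  have hmaj : Summable fun n : {n // n ∉ s} => C / L ^ 2 * (1 / ((n : ℤ) : ℝ) ^ 2) :=
    (hS.mul_left _).comp_injective Subtype.coe_injective
  rw [← hdiff.tsum_eq]
  refine (tsum_of_norm_bounded hmaj.hasSum fun n => hbound n n.2).trans ?_
  calc ∑' n : {n // n ∉ s}, C / L ^ 2 * (1 / ((n : ℤ) : ℝ) ^ 2)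
      ≤ ∑' n : ℤ, C / L ^ 2 * (1 / (n : ℝ) ^ 2) :=
        (hS.mul_left _).tsum_subtype_le (fun n : ℤ => C / L ^ 2 * (1 / (n : ℝ) ^ 2)) {n | n ∉ s}
          (fun n => by positivity)
    _ = _ := by rw [tsum_mul_left]; ring

theorem integral_norm_sq_expSum_le {ι : Type*} (s : Finset ι) (b : ι → ℂ) (θ : ι → ℝ) {B : ℝ}
    (hb : ∀ i ∈ s, ‖b i‖ ≤ B) :
    ∫ α, ‖∑ i ∈ s, b i * Complex.exp (((θ i * α : ℝ) : ℂ) * Complex.I)‖ ^ 2 ∂(gaussianReal 0 1) ≤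
      B ^ 2 * ∑ i ∈ s, ∑ j ∈ s, Real.exp (-(θ i - θ j) ^ 2 / 2) := by
  have hpt : ∀ α : ℝ, ((‖∑ i ∈ s, b i * Complex.exp (((θ i * α : ℝ) : ℂ) * Complex.I)‖ ^ 2 : ℝ) : ℂ)
      = ∑ i ∈ s, ∑ j ∈ s, b i * conj (b j) *
        Complex.exp ((θ i - θ j : ℝ) * α * Complex.I) := by
    intro α
    rw [Complex.ofReal_pow, ← Complex.mul_conj', map_sum, Finset.sum_mul_sum]
    refine Finset.sum_congr rfl fun i _ => Finset.sum_congr rfl fun j _ => ?_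
    rw [map_mul, ← Complex.exp_conj, mul_mul_mul_comm, ← Complex.exp_add]
    congr 2
    simp only [map_mul, Complex.conj_ofReal, Complex.conj_I]
    push_cast
    ring
  have hexp_int : ∀ t : ℝ, Integrable (fun α : ℝ => Complex.exp (t * α * Complex.I))
      (gaussianReal 0 1) := fun t => by
    refine Integrable.of_bound (C := 1) (by fun_prop) (ae_of_all _ fun α => ?_)
    rw [← Complex.ofReal_mul, Complex.norm_exp_ofReal_mul_I]
  have hval : ∀ t : ℝ, ∫ α : ℝ, Complex.exp (t * α * Complex.I) ∂(gaussianReal 0 1) =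
      ((Real.exp (-t ^ 2 / 2) : ℝ) : ℂ) := fun t => by
    rw [← charFun_apply_real, charFun_gaussianReal]
    push_cast
    congr 1
    simp
    ring
  have hkey : ((∫ α, ‖∑ i ∈ s, b i * Complex.exp (((θ i * α : ℝ) : ℂ) * Complex.I)‖ ^ 2
      ∂(gaussianReal 0 1) : ℝ) : ℂ) = ∑ i ∈ s, ∑ j ∈ s, b i * conj (b j) *
        ((Real.exp (-(θ i - θ j) ^ 2 / 2) : ℝ) : ℂ) := by
    rw [← integral_complex_ofReal]
    simp_rw [hpt]
    rw [integral_finsetSum _ fun i _ => integrable_finsetSum _ fun j _ => (hexp_int _).const_mul _]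
    refine Finset.sum_congr rfl fun i _ => ?_
    rw [integral_finsetSum _ fun j _ => (hexp_int _).const_mul _]
    refine Finset.sum_congr rfl fun j _ => ?_
    rw [integral_const_mul, hval]
  refine (Real.le_norm_self _).trans ?_
  rw [← Complex.norm_real, hkey]
  refine (norm_sum_le _ _).trans ?_
  rw [Finset.mul_sum]
  refine Finset.sum_le_sum fun i hi => (norm_sum_le _ _).trans ?_
  rw [Finset.mul_sum]
  refine Finset.sum_le_sum fun j hj => ?_
  rw [norm_mul, norm_mul, RCLike.norm_conj, Complex.norm_real, Real.norm_eq_abs, Real.abs_exp, sq B]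
  have := hb i hi
  have := hb j hj
  have := norm_nonneg (b i)
  gcongr
  linarith

/-- Bound for a second moment in terms of the number of nearly coinciding frequencies. -/
theorem integral_norm_sq_expSum_le_card {ι : Type*} (s : Finset ι) (b : ι → ℂ) (θ : ι → ℝ)
    {B K : ℝ} (hK : 0 ≤ K) (hb : ∀ i ∈ s, ‖b i‖ ≤ B) :
    ∫ α, ‖∑ i ∈ s, b i * Complex.exp (((θ i * α : ℝ) : ℂ) * Complex.I)‖ ^ 2 ∂(gaussianReal 0 1) ≤
      B ^ 2 * (({p ∈ s ×ˢ s | |θ p.1 - θ p.2| < K} : Finset (ι × ι)).card +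
        (s.card : ℝ) ^ 2 * Real.exp (-K ^ 2 / 2)) := by
  refine (integral_norm_sq_expSum_le s b θ hb).trans ?_
  refine mul_le_mul_of_nonneg_left ?_ (sq_nonneg B)
  rw [← Finset.sum_product' s s fun i j => Real.exp (-(θ i - θ j) ^ 2 / 2),
    ← Finset.sum_filter_add_sum_filter_not (s ×ˢ s) fun p => |θ p.1 - θ p.2| < K]
  refine add_le_add ?_ ?_
  · refine (Finset.sum_le_card_nsmul _ _ 1 fun p _ => ?_).trans (by simp)
    rw [Real.exp_le_one_iff]
    have := sq_nonneg (θ p.1 - θ p.2)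
    linarith
  · refine (Finset.sum_le_card_nsmul _ _ (Real.exp (-K ^ 2 / 2)) fun p hp => ?_).trans ?_
    · rw [Finset.mem_filter, not_lt] at hp
      have := pow_le_pow_left₀ hK hp.2 2
      rw [sq_abs] at this
      gcongr
    · rw [nsmul_eq_mul]
      gcongr
      calc ((Finset.filter _ (s ×ˢ s)).card : ℝ) ≤ ((s ×ˢ s).card : ℝ) := by
            exact_mod_cast Finset.card_filter_le _ _
        _ = _ := by rw [Finset.card_product]; push_cast; ring

/-- The index set of triples `(n, x, y)` with `1 ≤ |n| ≤ N ^ (1 + ε)` and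
`1 ≤ x ≠ y ≤ N`. -/
noncomputable def freqIndex (ε : ℝ) (N : ℕ) : Finset (ℤ × ℕ × ℕ) :=
  (Finset.Icc (-⌊(N : ℝ) ^ (1 + ε)⌋) ⌊(N : ℝ) ^ (1 + ε)⌋).erase 0 ×ˢ (Finset.Icc 1 N).offDiag

theorem mem_Icc_floor_iff {M : ℝ} {n : ℤ} : n ∈ Finset.Icc (-⌊M⌋) ⌊M⌋ ↔ |(n : ℝ)| ≤ M := by
  rw [Finset.mem_Icc, ← abs_le, Int.le_floor, Int.cast_abs]

theorem card_freqIndex_le {ε : ℝ} (hε : 0 < ε) {N : ℕ} (hN : 1 ≤ N) :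
    ((freqIndex ε N).card : ℝ) ≤ 3 * (N : ℝ) ^ (1 + ε) * (N : ℝ) ^ 2 := by
  have hN' : (1 : ℝ) ≤ N := by exact_mod_cast hN
  have hM : (1 : ℝ) ≤ (N : ℝ) ^ (1 + ε) := Real.one_le_rpow hN' (by linarith)
  set M := (N : ℝ) ^ (1 + ε)
  have hfl : (0 : ℤ) ≤ ⌊M⌋ := Int.floor_nonneg.2 (by linarith)
  rw [freqIndex, Finset.card_product, Nat.cast_mul]
  refine mul_le_mul ?_ ?_ (by positivity) (by positivity)
  · calc (((Finset.Icc (-⌊M⌋) ⌊M⌋).erase 0).card : ℝ) ≤ ((Finset.Icc (-⌊M⌋) ⌊M⌋).card : ℝ) := by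
          exact_mod_cast Finset.card_erase_le
      _ = 2 * (⌊M⌋ : ℝ) + 1 := by
          rw [Int.card_Icc]
          have : ((⌊M⌋ + 1 - -⌊M⌋).toNat : ℤ) = 2 * ⌊M⌋ + 1 := by
            rw [Int.toNat_of_nonneg (by linarith)]
            ring
          exact_mod_cast this
      _ ≤ 3 * M := by linarith [Int.floor_le M]
  · calc ((Finset.Icc 1 N).offDiag.card : ℝ)
        ≤ (((Finset.Icc 1 N) ×ˢ (Finset.Icc 1 N)).card : ℝ) := by
          exact_mod_cast Finset.card_le_card (fun p hp => by
            rw [Finset.mem_offDiag] at hp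
            exact Finset.mem_product.2 ⟨hp.1, hp.2.1⟩)
      _ = _ := by simp [sq]

theorem card_filter_freqIndex_le_countB (a : ℕ → ℝ) (ε K : ℝ) (N : ℕ) :
    ({p ∈ freqIndex ε N ×ˢ freqIndex ε N |
      |2 * Real.pi * (p.1.1 * (a p.1.2.1 - a p.1.2.2)) -
        2 * Real.pi * (p.2.1 * (a p.2.2.1 - a p.2.2.2))| < 2 * Real.pi * K} :
        Finset ((ℤ × ℕ × ℕ) × (ℤ × ℕ × ℕ))).card ≤ countB a ((N : ℝ) ^ (1 + ε)) K N := by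
  rw [← Set.ncard_coe_finset, countB]
  refine Set.ncard_le_ncard_of_injOn
    (fun p => (p.1.1, p.2.1, p.1.2.1, p.1.2.2, p.2.2.1, p.2.2.2)) ?_ ?_ ?_
  · rintro ⟨⟨n, x, y⟩, ⟨n', x', y'⟩⟩ h
    simp only [freqIndex, Finset.coe_filter, Finset.mem_product, Finset.mem_erase,
      Finset.mem_offDiag, Finset.mem_Icc, Set.mem_ofPred_eq] at h ⊢
    obtain ⟨⟨⟨⟨h1, h2⟩, ⟨h3, h4⟩, ⟨h5, h6⟩, h7⟩, ⟨h8, h9⟩, ⟨h10, h11⟩, ⟨h12, h13⟩, h14⟩, h15⟩ := h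
    refine ⟨Int.one_le_abs h1, mem_Icc_floor_iff.1 (Finset.mem_Icc.2 h2), Int.one_le_abs h8,
      mem_Icc_floor_iff.1 (Finset.mem_Icc.2 h9), h3, h4, h5, h6, h7, h10, h11, h12, h13,
      h14, ?_⟩
    rw [← mul_sub, abs_mul, abs_of_pos (by positivity)] at h15
    exact lt_of_mul_lt_mul_left h15 (by positivity)
  · rintro ⟨⟨n, x, y⟩, ⟨n', x', y'⟩⟩ _ ⟨⟨m, u, v⟩, ⟨m', u', v'⟩⟩ _ h
    simp only [Prod.mk.injEq] at h ⊢
    tauto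
  · refine Set.Finite.subset (Finset.finite_toSet
      (Finset.Icc (-⌊(N : ℝ) ^ (1 + ε)⌋) ⌊(N : ℝ) ^ (1 + ε)⌋ ×ˢ
        Finset.Icc (-⌊(N : ℝ) ^ (1 + ε)⌋) ⌊(N : ℝ) ^ (1 + ε)⌋ ×ˢ
        Finset.Icc 1 N ×ˢ Finset.Icc 1 N ×ˢ Finset.Icc 1 N ×ˢ Finset.Icc 1 N)) ?_
    rintro ⟨n, n', x, y, x', y'⟩ h
    simp only [Set.mem_ofPred_eq] at h
    simp only [Finset.coe_product, Set.mem_prod, Finset.mem_coe, ← mem_Icc_floor_iff,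
      Finset.mem_Icc] at h ⊢
    tauto

theorem exists_rpow_mul_exp_neg_le {ε : ℝ} (hε : 0 < ε) (p q : ℝ) :
    ∃ C : ℝ, 0 < C ∧ ∀ x : ℝ, 1 ≤ x →
      x ^ p * Real.exp (-(2 * Real.pi * x ^ ε) ^ 2 / 2) ≤ C * x ^ q := by
  obtain ⟨m, hm⟩ := exists_nat_ge ((p - q) / ε)
  rw [div_le_iff₀ hε] at hm
  refine ⟨m.factorial, by positivity, fun x hx => ?_⟩
  have hx0 : 0 < x := by linarith
  have hxe : 1 ≤ x ^ ε := Real.one_le_rpow hx hε.le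
  have h1 : x ^ ε ≤ (2 * Real.pi * x ^ ε) ^ 2 / 2 := by
    have hpi := Real.pi_gt_three
    have : 1 ≤ Real.pi ^ 2 := by nlinarith
    have h3 : x ^ ε ≤ (x ^ ε) ^ 2 := by nlinarith
    calc x ^ ε ≤ (x ^ ε) ^ 2 := h3
      _ ≤ 2 * (Real.pi ^ 2 * (x ^ ε) ^ 2) := by nlinarith [sq_nonneg (x ^ ε)]
      _ = _ := by ring
  have h2 : (x ^ ε) ^ m / m.factorial ≤ Real.exp ((2 * Real.pi * x ^ ε) ^ 2 / 2) :=
    (Real.pow_div_factorial_le_exp _ (by positivity) m).trans (Real.exp_le_exp.2 h1)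
  rw [neg_div, Real.exp_neg, ← div_eq_mul_inv, div_le_iff₀ (Real.exp_pos _)]
  have h3 : x ^ (p - q) ≤ (x ^ ε) ^ m := by
    rw [← Real.rpow_natCast, ← Real.rpow_mul hx0.le]
    exact Real.rpow_le_rpow_of_exponent_le hx (by linarith)
  calc x ^ p = x ^ q * x ^ (p - q) := by rw [← Real.rpow_add hx0]; ring_nf
    _ ≤ x ^ q * (x ^ ε) ^ m := by gcongr
    _ = m.factorial * x ^ q * ((x ^ ε) ^ m / m.factorial) := by field_simp
    _ ≤ _ := by gcongr

/-- The oscillating part of the truncated Fourier expansion of a smoothed pair correlation function. -/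
noncomputable def oscPart (a : ℕ → ℝ) (f : 𝓢(ℝ, ℂ)) (ε : ℝ) (N : ℕ) (α : ℝ) : ℂ :=
  ∑ i ∈ freqIndex ε N, (((N : ℝ)⁻¹ ^ 2 : ℝ) : ℂ) * 𝓕 f (i.1 / N) *
    Complex.exp (((2 * Real.pi * (i.1 * (a i.2.1 - a i.2.2)) * α : ℝ) : ℂ) * Complex.I)

theorem continuous_oscPart (a : ℕ → ℝ) (f : 𝓢(ℝ, ℂ)) (ε : ℝ) (N : ℕ) :
    Continuous (oscPart a f ε N) := by
  unfold oscPart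
  fun_prop

theorem exists_integral_norm_sq_oscPart_le (a : ℕ → ℝ) (f : 𝓢(ℝ, ℂ)) {ε δ c : ℝ} (hε : 0 < ε)
    (hB : ∀ N : ℕ, 1 ≤ N →
      (countB a ((N : ℝ) ^ (1 + ε)) ((N : ℝ) ^ ε) N : ℝ) ≤ c * (N : ℝ) ^ (4 - δ)) :
    ∃ C : ℝ, ∀ N : ℕ, 1 ≤ N →
      ∫ α, ‖oscPart a f ε N α‖ ^ 2 ∂(gaussianReal 0 1) ≤ C * (N : ℝ) ^ (-δ) := by
  obtain ⟨D, hD0, hD⟩ := (𝓕 f).decay 0 0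
  simp only [norm_iteratedFDeriv_zero, pow_zero, one_mul] at hD
  obtain ⟨C, hC0, hC⟩ := exists_rpow_mul_exp_neg_le hε (6 + 2 * ε) (4 - δ)
  refine ⟨D ^ 2 * (c + 9 * C), fun N hN => ?_⟩
  have hN' : (1 : ℝ) ≤ N := by exact_mod_cast hN
  have hN0 : (0 : ℝ) < N := by linarith
  refine (integral_norm_sq_expSum_le_card (freqIndex ε N) _
    (fun i => 2 * Real.pi * (i.1 * (a i.2.1 - a i.2.2)))
    (B := (N : ℝ)⁻¹ ^ 2 * D) (K := 2 * Real.pi * (N : ℝ) ^ ε) (by positivity)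
    fun i _ => ?_).trans ?_
  · rw [norm_mul, Complex.norm_real, Real.norm_of_nonneg (by positivity)]
    gcongr
    exact hD _
  · have h1 := (Nat.cast_le (α := ℝ)).2 (card_filter_freqIndex_le_countB a ε ((N : ℝ) ^ ε) N)
    have h2 := card_freqIndex_le hε hN
    have h3 := hC N hN'
    have h4 := hB N hN
    have h5 : ((freqIndex ε N).card : ℝ) ^ 2 ≤ 9 * (N : ℝ) ^ (6 + 2 * ε) := by
      calc ((freqIndex ε N).card : ℝ) ^ 2 ≤ (3 * (N : ℝ) ^ (1 + ε) * (N : ℝ) ^ 2) ^ 2 := by gcongr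
        _ = 9 * (((N : ℝ) ^ (1 + ε)) ^ 2 * (N : ℝ) ^ 4) := by ring
        _ = 9 * (N : ℝ) ^ (6 + 2 * ε) := by
          rw [← Real.rpow_natCast, ← Real.rpow_natCast, ← Real.rpow_mul hN0.le,
            ← Real.rpow_add hN0]
          congr 2
          push_cast
          ring
    calc _ ≤ ((N : ℝ)⁻¹ ^ 2 * D) ^ 2 * (c * (N : ℝ) ^ (4 - δ) + 9 * (C * (N : ℝ) ^ (4 - δ))) := by
          refine mul_le_mul_of_nonneg_left (add_le_add (h1.trans h4) ?_) (sq_nonneg _)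
          calc _ ≤ 9 * (N : ℝ) ^ (6 + 2 * ε) *
                Real.exp (-(2 * Real.pi * (N : ℝ) ^ ε) ^ 2 / 2) := by gcongr
            _ ≤ _ := by rw [mul_assoc]; gcongr
      _ = D ^ 2 * (c + 9 * C) * (((N : ℝ) ^ 4)⁻¹ * (N : ℝ) ^ (4 - δ)) := by
          field_simp
      _ = _ := by
          rw [← Real.rpow_natCast (N : ℝ) 4, ← Real.rpow_neg hN0.le, ← Real.rpow_add hN0]
          congr 2
          push_cast
          ring

theorem ae_tendsto_zero_of_summable_integral_norm_sq {μ : Measure ℝ} [IsProbabilityMeasure μ]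
    {g : ℕ → ℝ → ℂ} (hg : ∀ k, Integrable (fun α => ‖g k α‖ ^ 2) μ)
    (hsum : Summable fun k => ∫ α, ‖g k α‖ ^ 2 ∂μ) :
    ∀ᵐ α ∂μ, Tendsto (fun k => g k α) atTop (nhds 0) := by
  have hmeas : ∀ k, AEMeasurable (fun α => ENNReal.ofReal (‖g k α‖ ^ 2)) μ := fun k =>
    (hg k).aemeasurable.ennreal_ofReal
  have h1 : ∫⁻ α, ∑' k, ENNReal.ofReal (‖g k α‖ ^ 2) ∂μ ≠ ⊤ := by
    rw [lintegral_tsum hmeas]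
    simp_rw [← ofReal_integral_eq_lintegral_ofReal (hg _) (ae_of_all _ fun α => sq_nonneg _)]
    exact hsum.tsum_ofReal_ne_top
  filter_upwards [ae_lt_top' (AEMeasurable.tsum hmeas) h1] with α hα
  have h2 := ENNReal.tendsto_atTop_zero_of_tsum_ne_top hα.ne
  have h3 := (ENNReal.tendsto_toReal ENNReal.zero_ne_top).comp h2
  simp only [Function.comp_def, ENNReal.toReal_zero, ENNReal.toReal_ofReal (sq_nonneg _)] at h3
  rw [tendsto_zero_iff_norm_tendsto_zero]
  have h4 := h3.sqrt
  simpa [Real.sqrt_sq (norm_nonneg _)] using h4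

theorem ae_tendsto_oscPart (a : ℕ → ℝ) (f : 𝓢(ℝ, ℂ)) {ε δ c : ℝ} (hε : 0 < ε)
    (hB : ∀ N : ℕ, 1 ≤ N →
      (countB a ((N : ℝ) ^ (1 + ε)) ((N : ℝ) ^ ε) N : ℝ) ≤ c * (N : ℝ) ^ (4 - δ))
    {r : ℕ} (hr : 1 < r * δ) :
    ∀ᵐ α, Tendsto (fun k : ℕ => oscPart a f ε ((k + 1) ^ r) α) atTop (nhds 0) := by
  obtain ⟨C, hC⟩ := exists_integral_norm_sq_oscPart_le a f hε hB
  refine (gaussianReal_absolutelyContinuous' 0 one_ne_zero).ae_le ?_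
  refine ae_tendsto_zero_of_summable_integral_norm_sq (fun k => ?_) ?_
  · have hcont : Continuous fun α => ‖oscPart a f ε ((k + 1) ^ r) α‖ ^ 2 :=
      (continuous_oscPart a f ε _).norm.pow 2
    refine Integrable.of_bound (C := (∑ i ∈ freqIndex ε ((k + 1) ^ r),
      ‖(((((k + 1) ^ r : ℕ) : ℝ)⁻¹ ^ 2 : ℝ) : ℂ) * 𝓕 f (i.1 / ((k + 1) ^ r : ℕ))‖) ^ 2)
      hcont.aestronglyMeasurable (ae_of_all _ fun α => ?_)
    rw [Real.norm_of_nonneg (sq_nonneg _)]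
    gcongr
    refine (norm_sum_le _ _).trans (Finset.sum_le_sum fun i _ => ?_)
    rw [norm_mul, Complex.norm_exp_ofReal_mul_I, mul_one]
  · have hs : Summable fun k : ℕ => C * ((k + 1 : ℕ) : ℝ) ^ (-(r * δ)) :=
      ((summable_nat_add_iff 1).2 (Real.summable_nat_rpow.2 (by linarith))).mul_left C
    refine Summable.of_nonneg_of_le (fun k => integral_nonneg fun α => sq_nonneg _)
      (fun k => ?_) hs
    refine (hC _ (Nat.one_le_pow _ _ k.succ_pos)).trans_eq ?_
    rw [Nat.cast_pow, ← Real.rpow_natCast, ← Real.rpow_mul (by positivity), mul_neg]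

theorem norm_sum_periodization_sub_le (a : ℕ → ℝ) (f : 𝓢(ℝ, ℂ)) {ε : ℝ} (hε : 0 < ε) :
    ∃ C : ℝ, ∀ N : ℕ, 1 ≤ N → ∀ α : ℝ,
      ‖(∑ p ∈ (Finset.Icc 1 N).offDiag, ∑' k : ℤ, f (N * (α * a p.1 - α * a p.2 + k))) / N -
        (1 - (N : ℂ)⁻¹) * 𝓕 f 0 - oscPart a f ε N α‖ ≤ C / N := by
  obtain ⟨C, hC⟩ := exists_norm_periodization_sub_le f hε
  refine ⟨C, fun N hN α => ?_⟩
  have hN' : (1 : ℝ) ≤ N := by exact_mod_cast hN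
  have hN0 : (0 : ℝ) < N := by linarith
  have hNc : (N : ℂ) ≠ 0 := by exact_mod_cast hN0.ne'
  set s := Finset.Icc (-⌊(N : ℝ) ^ (1 + ε)⌋) ⌊(N : ℝ) ^ (1 + ε)⌋ with hs
  have hs0 : (0 : ℤ) ∈ s := by
    rw [hs, mem_Icc_floor_iff, Int.cast_zero, abs_zero]
    positivity
  set T : ℕ × ℕ → ℂ := fun p => ∑' k : ℤ, f (N * (α * a p.1 - α * a p.2 + k))
  set A : ℕ × ℕ → ℤ → ℂ := fun p n => (((N : ℝ)⁻¹ : ℝ) : ℂ) * 𝓕 f (n / (N : ℝ)) *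
        Complex.exp (((2 * Real.pi * n * (α * a p.1 - α * a p.2) : ℝ) : ℂ) * Complex.I) with hA
  have h1 : ∀ p, ‖T p - ∑ n ∈ s, A p n‖ ≤ C / (N : ℝ) ^ 2 := fun p =>
    hC N hN' s (fun n hn => mem_Icc_floor_iff.2 hn) (α * a p.1 - α * a p.2)
  have hA0 : ∀ p, A p 0 = (N : ℂ)⁻¹ * 𝓕 f 0 := fun p => by simp [hA]
  have hcardN : (Finset.Icc 1 N).offDiag.card = N * N - N := by simp
  have hcard : ((Finset.Icc 1 N).offDiag.card : ℂ) = (N : ℂ) * N - N := by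
    rw [hcardN, Nat.cast_sub (Nat.le_mul_self N), Nat.cast_mul]
  have hcard' : ((Finset.Icc 1 N).offDiag.card : ℝ) ≤ (N : ℝ) ^ 2 := by
    rw [hcardN, Nat.cast_sub (Nat.le_mul_self N), Nat.cast_mul]
    nlinarith
  have hosc : oscPart a f ε N α =
      (∑ p ∈ (Finset.Icc 1 N).offDiag, ∑ n ∈ s.erase 0, A p n) / N := by
    rw [oscPart, freqIndex, Finset.sum_product_right, Finset.sum_div]
    refine Finset.sum_congr rfl fun p _ => ?_
    rw [Finset.sum_div]
    refine Finset.sum_congr rfl fun n _ => ?_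
    rw [hA]
    have : 2 * Real.pi * (n * (a p.1 - a p.2)) * α =
      2 * Real.pi * n * (α * a p.1 - α * a p.2) := by ring
    simp only [this]
    push_cast
    ring
  have hkey : (∑ p ∈ (Finset.Icc 1 N).offDiag, T p) / N - (1 - (N : ℂ)⁻¹) * 𝓕 f 0 -
      oscPart a f ε N α =
      (∑ p ∈ (Finset.Icc 1 N).offDiag, (T p - ∑ n ∈ s, A p n)) / N := by
    have h2 : ∀ p, ∑ n ∈ s, A p n = (N : ℂ)⁻¹ * 𝓕 f 0 + ∑ n ∈ s.erase 0, A p n := fun p => by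
      rw [← Finset.add_sum_erase s _ hs0, hA0]
    simp_rw [h2]
    rw [Finset.sum_sub_distrib, Finset.sum_add_distrib, Finset.sum_const, nsmul_eq_mul, hcard, hosc]
    field_simp
    ring
  have hC0 : 0 ≤ C / (N : ℝ) ^ 2 := (norm_nonneg _).trans (h1 (0, 0))
  rw [hkey, norm_div, Complex.norm_natCast]
  refine div_le_div_of_nonneg_right ?_ hN0.le
  calc _ ≤ ∑ p ∈ (Finset.Icc 1 N).offDiag, C / (N : ℝ) ^ 2 :=
        norm_sum_le_of_le _ fun p _ => h1 p
    _ = (Finset.Icc 1 N).offDiag.card * (C / (N : ℝ) ^ 2) := by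
        rw [Finset.sum_const, nsmul_eq_mul]
    _ ≤ (N : ℝ) ^ 2 * (C / (N : ℝ) ^ 2) := by gcongr
    _ = C := by field_simp

theorem tendsto_sum_periodization_div (a : ℕ → ℝ) (f : 𝓢(ℝ, ℂ)) {ε : ℝ} (hε : 0 < ε) {α : ℝ}
    {u : ℕ → ℕ} (hu : Tendsto u atTop atTop)
    (h : Tendsto (fun k => oscPart a f ε (u k) α) atTop (nhds 0)) :
    Tendsto (fun k => (∑ p ∈ (Finset.Icc 1 (u k)).offDiag,
      ∑' l : ℤ, f (u k * (α * a p.1 - α * a p.2 + l))) / (u k : ℂ)) atTop (nhds (𝓕 f 0)) := by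
  obtain ⟨C, hC⟩ := norm_sum_periodization_sub_le a f hε
  have h1 : Tendsto (fun k => C / (u k : ℝ)) atTop (nhds 0) :=
    (tendsto_const_div_atTop_nhds_zero_nat C).comp hu
  have h2 := squeeze_zero_norm' ((hu.eventually (eventually_ge_atTop 1)).mono
    fun k hk => hC (u k) hk α) h1
  have h3 : Tendsto (fun k => (1 - (u k : ℂ)⁻¹) * 𝓕 f 0) atTop (nhds (𝓕 f 0)) := by
    have := ((tendsto_inv_atTop_nhds_zero_nat (𝕜 := ℂ)).comp hu).const_sub 1 |>.mul_const (𝓕 f 0)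
    simpa using this
  simpa using (h2.add h).add h3

theorem tsum_contDiffBump_mul_add (φ : ContDiffBump (0 : ℝ)) {L : ℝ} (hL : 2 * φ.rOut ≤ L) (t : ℝ) :
    ∑' k : ℤ, (φ (L * (t + k)) : ℂ) = φ (L * (t - round t)) := by
  have hL0 : 0 < L := by linarith [φ.rOut_pos]
  rw [tsum_eq_single (-round t)]
  · push_cast
    ring_nf
  · intro k hk
    rw [φ.zero_of_le_dist, Complex.ofReal_zero]
    have h1 : (1 : ℝ) ≤ |((round t + k : ℤ) : ℝ)| := by
      rw [← Int.cast_abs]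
      exact_mod_cast Int.one_le_abs fun h => hk (by linarith)
    have h2 := abs_sub_round t
    have h3 : (1 : ℝ) / 2 ≤ |t + k| := by
      have h4 : ((round t + k : ℤ) : ℝ) = (t + k) - (t - round t) := by
        push_cast
        ring
      rw [h4] at h1
      linarith [abs_sub (t + k) (t - round t)]
    rw [dist_zero_right, Real.norm_eq_abs, abs_mul, abs_of_pos hL0]
    nlinarith

/-- The number of pairs `1 ≤ m ≠ n ≤ N` for which `α * (a m - a n)` is within `ρ` of an integer. -/
noncomputable def pairCount (a : ℕ → ℝ) (α : ℝ) (N : ℕ) (ρ : ℝ) : ℕ :=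
  Set.ncard {p : ℕ × ℕ | 1 ≤ p.1 ∧ p.1 ≤ N ∧ 1 ≤ p.2 ∧ p.2 ≤ N ∧ p.1 ≠ p.2 ∧
    |α * a p.1 - α * a p.2 - (round (α * a p.1 - α * a p.2) : ℝ)| ≤ ρ}

theorem pairCount_eq_card (a : ℕ → ℝ) (α : ℝ) (N : ℕ) (ρ : ℝ) :
    pairCount a α N ρ = ({p ∈ (Finset.Icc 1 N).offDiag |
      |α * a p.1 - α * a p.2 - (round (α * a p.1 - α * a p.2) : ℝ)| ≤ ρ} :
        Finset (ℕ × ℕ)).card := by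
  rw [pairCount, ← Set.ncard_coe_finset]
  congr 1
  ext p
  simp only [Set.mem_ofPred_eq, Finset.coe_filter, Finset.mem_offDiag, Finset.mem_Icc]
  tauto

theorem pairCount_mono (a : ℕ → ℝ) (α : ℝ) {M N : ℕ} {ρ ρ' : ℝ} (hMN : M ≤ N) (hρ : ρ ≤ ρ') :
    pairCount a α M ρ ≤ pairCount a α N ρ' := by
  rw [pairCount_eq_card, pairCount_eq_card]
  refine Finset.card_le_card fun p hp => ?_
  simp only [Finset.mem_filter, Finset.mem_offDiag, Finset.mem_Icc] at hp ⊢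
  obtain ⟨⟨⟨h1, h2⟩, ⟨h3, h4⟩, h5⟩, h6⟩ := hp
  exact ⟨⟨⟨h1, h2.trans hMN⟩, ⟨h3, h4.trans hMN⟩, h5⟩, h6.trans hρ⟩

theorem pairCount_le_sum (a : ℕ → ℝ) (α : ℝ) (φ : ContDiffBump (0 : ℝ)) {N : ℕ} (hN : 0 < N) :
    (pairCount a α N (φ.rIn / N) : ℝ) ≤ ∑ p ∈ (Finset.Icc 1 N).offDiag,
      φ (N * ((α * a p.1 - α * a p.2) - round (α * a p.1 - α * a p.2))) := by
  have hN0 : (0 : ℝ) < N := by exact_mod_cast hN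
  rw [pairCount_eq_card, Finset.card_filter, Nat.cast_sum]
  refine Finset.sum_le_sum fun p _ => ?_
  split_ifs with h
  · rw [Nat.cast_one, φ.one_of_mem_closedBall]
    rw [mem_closedBall_zero_iff, Real.norm_eq_abs, abs_mul, abs_of_pos hN0]
    rwa [le_div_iff₀ hN0, mul_comm] at h
  · simpa using φ.nonneg

theorem sum_le_pairCount (a : ℕ → ℝ) (α : ℝ) (φ : ContDiffBump (0 : ℝ)) {N : ℕ} (hN : 0 < N) :
    ∑ p ∈ (Finset.Icc 1 N).offDiag,
      φ (N * ((α * a p.1 - α * a p.2) - round (α * a p.1 - α * a p.2))) ≤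
    (pairCount a α N (φ.rOut / N) : ℝ) := by
  have hN0 : (0 : ℝ) < N := by exact_mod_cast hN
  rw [pairCount_eq_card, Finset.card_filter, Nat.cast_sum]
  refine Finset.sum_le_sum fun p _ => ?_
  split_ifs with h
  · simpa using φ.le_one
  · rw [φ.zero_of_le_dist, Nat.cast_zero]
    rw [dist_zero_right, Real.norm_eq_abs, abs_mul, abs_of_pos hN0]
    rw [not_le, div_lt_iff₀ hN0, mul_comm] at h
    exact h.le

/-- A smooth bump function as a complex-valued Schwartz function. -/
noncomputable def bumpSchwartz (φ : ContDiffBump (0 : ℝ)) : 𝓢(ℝ, ℂ) :=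
  HasCompactSupport.toSchwartzMap (f := fun x => (φ x : ℂ))
    (φ.hasCompactSupport.comp_left Complex.ofReal_zero)
    (Complex.ofRealCLM.contDiff.comp φ.contDiff)

theorem bumpSchwartz_apply (φ : ContDiffBump (0 : ℝ)) (x : ℝ) : bumpSchwartz φ x = φ x := rfl

theorem fourier_bumpSchwartz_zero (φ : ContDiffBump (0 : ℝ)) :
    𝓕 (bumpSchwartz φ) 0 = ((∫ x, φ x : ℝ) : ℂ) := by
  rw [SchwartzMap.fourier_coe, Real.fourier_real_eq_integral_exp_smul, ← integral_complex_ofReal]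
  simp [bumpSchwartz_apply]

theorem tendsto_sum_contDiffBump_div (a : ℕ → ℝ) (φ : ContDiffBump (0 : ℝ)) {ε : ℝ} (hε : 0 < ε)
    {α : ℝ} {u : ℕ → ℕ} (hu : Tendsto u atTop atTop)
    (h : Tendsto (fun k => oscPart a (bumpSchwartz φ) ε (u k) α) atTop (nhds 0)) :
    Tendsto (fun k => (∑ p ∈ (Finset.Icc 1 (u k)).offDiag,
      φ (u k * ((α * a p.1 - α * a p.2) - round (α * a p.1 - α * a p.2)))) / (u k : ℝ)) atTop
      (nhds (∫ x, φ x)) := by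
  have h1 := tendsto_sum_periodization_div a (bumpSchwartz φ) hε hu h
  rw [fourier_bumpSchwartz_zero] at h1
  have h2 := (Complex.continuous_re.tendsto _).comp h1
  rw [Complex.ofReal_re] at h2
  refine h2.congr' (((tendsto_natCast_atTop_atTop (R := ℝ)).comp hu |>.eventually
    (eventually_ge_atTop (2 * φ.rOut))).mono fun k hk => ?_)
  simp only [Function.comp_apply] at hk ⊢
  simp_rw [bumpSchwartz_apply, tsum_contDiffBump_mul_add φ hk]
  rw [← Complex.ofReal_sum, ← Complex.ofReal_natCast, ← Complex.ofReal_div, Complex.ofReal_re]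

theorem tendsto_pairCount_of_contDiffBump (a : ℕ → ℝ) {α : ℝ} {u : ℕ → ℕ}
    (hu : Tendsto u atTop atTop)
    (h : ∀ p q : ℚ, 0 < p → p < q → ∃ φ : ContDiffBump (0 : ℝ), φ.rIn = p ∧ φ.rOut = q ∧
      Tendsto (fun k => (∑ p ∈ (Finset.Icc 1 (u k)).offDiag,
        φ (u k * ((α * a p.1 - α * a p.2) - round (α * a p.1 - α * a p.2)))) / (u k : ℝ)) atTop
        (nhds (∫ x, φ x)))
    {s : ℝ} (hs : 0 < s) :
    Tendsto (fun k => (pairCount a α (u k) (s / u k) : ℝ) / u k) atTop (nhds (2 * s)) := by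
  have hvol : ∀ ρ : ℝ, 0 ≤ ρ → (volume : Measure ℝ).real (Metric.closedBall 0 ρ) = 2 * ρ :=
    fun ρ hρ => Real.volume_real_closedBall hρ
  refine tendsto_order.2 ⟨fun b hb => ?_, fun b hb => ?_⟩
  · obtain ⟨p, hp1, hp2⟩ := exists_rat_btwn (show max (b / 2) 0 < s from
      max_lt (by linarith) hs)
    obtain ⟨q, hq1, hq2⟩ := exists_rat_btwn hp2
    have hp0 : (0 : ℝ) < p := (le_max_right _ _).trans_lt hp1
    have hpb := (le_max_left (b / 2) 0).trans_lt hp1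
    obtain ⟨φ, hin, hout, hφ⟩ := h p q (by exact_mod_cast hp0) (by exact_mod_cast hq1)
    have hI : b < ∫ x, φ x := by
      have := φ.measure_closedBall_le_integral (μ := volume)
      rw [hin, hvol _ hp0.le] at this
      linarith
    filter_upwards [hφ.eventually_const_lt hI, hu.eventually (eventually_gt_atTop 0)] with k h1 h2
    have hk : (0 : ℝ) < u k := by exact_mod_cast h2
    refine h1.trans_le (div_le_div_of_nonneg_right ?_ hk.le)
    refine (sum_le_pairCount a α φ h2).trans (Nat.cast_le.2 (pairCount_mono a α le_rfl ?_))
    rw [hout]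
    gcongr
  · obtain ⟨q, hq1, hq2⟩ := exists_rat_btwn (show s < b / 2 by linarith)
    obtain ⟨p, hp1, hp2⟩ := exists_rat_btwn hq1
    have hp0 : (0 : ℝ) < p := hs.trans hp1
    obtain ⟨φ, hin, hout, hφ⟩ := h p q (by exact_mod_cast hp0) (by exact_mod_cast hp2)
    have hI : ∫ x, φ x < b := by
      have := φ.integral_le_measure_closedBall (μ := volume)
      rw [hout, hvol _ (hp0.trans hp2).le] at this
      linarith
    filter_upwards [hφ.eventually_lt_const hI, hu.eventually (eventually_gt_atTop 0)] with k h1 h2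
    have hk : (0 : ℝ) < u k := by exact_mod_cast h2
    refine lt_of_le_of_lt (div_le_div_of_nonneg_right ?_ hk.le) h1
    refine (Nat.cast_le.2 (pairCount_mono a α le_rfl ?_)).trans (pairCount_le_sum a α φ h2)
    rw [hin]
    gcongr

theorem tendsto_div_of_tendsto_div_pow {c : ℕ → ℝ → ℝ} (h0 : ∀ N ρ, 0 ≤ c N ρ)
    (hmono : ∀ M N ρ ρ', M ≤ N → ρ ≤ ρ' → c M ρ ≤ c N ρ') {r : ℕ} (hr : r ≠ 0)
    (H : ∀ s : ℝ, 0 < s →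
      Tendsto (fun k : ℕ => c (k ^ r) (s / (k : ℝ) ^ r) / (k : ℝ) ^ r) atTop (nhds (2 * s)))
    {s : ℝ} (hs : 0 < s) :
    Tendsto (fun N : ℕ => c N (s / N) / N) atTop (nhds (2 * s)) := by
  have hm : Tendsto (fun N : ℕ => Nat.nthRoot r N) atTop atTop :=
    tendsto_atTop.2 fun b => (eventually_ge_atTop (b ^ r)).mono fun N hN =>
      (Nat.le_nthRoot_iff hr).2 hN
  have hratio : Tendsto (fun k : ℕ => ((k + 1 : ℕ) : ℝ) ^ r / (k : ℝ) ^ r) atTop (nhds 1) := by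
    have h1 : Tendsto (fun k : ℕ => (1 + 1 / (k : ℝ)) ^ r) atTop (nhds 1) := by
      simpa using (tendsto_one_div_atTop_nhds_zero_nat (𝕜 := ℝ)).const_add 1 |>.pow r
    refine h1.congr' ((eventually_ge_atTop 1).mono fun k hk => ?_)
    have hk0 : (k : ℝ) ≠ 0 := by positivity
    beta_reduce
    rw [← div_pow, Nat.cast_add, Nat.cast_one, add_div, div_self hk0]
  have hle : ∀ N : ℕ, ((Nat.nthRoot r N : ℕ) : ℝ) ^ r ≤ N := fun N => by
    exact_mod_cast (Nat.le_nthRoot_iff hr).1 le_rfl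
  have hlt : ∀ N : ℕ, (N : ℝ) ≤ ((Nat.nthRoot r N + 1 : ℕ) : ℝ) ^ r := fun N => by
    exact_mod_cast (Nat.lt_pow_nthRoot_add_one hr N).le
  refine tendsto_order.2 ⟨fun b hb => ?_, fun b hb => ?_⟩
  · obtain ⟨s', hs'1, hs'2⟩ := exists_between (show max (b / 2) 0 < s from
      max_lt (by linarith) hs)
    have hs'0 : 0 < s' := (le_max_right _ _).trans_lt hs'1
    have hs'b : b < 2 * s' := by linarith [(le_max_left (b / 2) 0).trans_lt hs'1]
    have h1 := (H s' hs'0).div hratio one_ne_zero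
    rw [div_one] at h1
    filter_upwards [hm.eventually (h1.eventually_const_lt hs'b),
      hm.eventually (hratio.eventually_lt_const ((one_lt_div hs'0).2 hs'2)),
      hm.eventually (eventually_ge_atTop 1)] with N h2 h3 h4
    have hNle := hle N
    have hNlt := hlt N
    have hfl : (Nat.nthRoot r N) ^ r ≤ N := (Nat.le_nthRoot_iff hr).1 le_rfl
    set k := Nat.nthRoot r N
    have hk : (0 : ℝ) < (k : ℝ) ^ r := by positivity
    have hN : (0 : ℝ) < N := hk.trans_le hNle
    have hk1 : (0 : ℝ) < ((k + 1 : ℕ) : ℝ) ^ r := by positivity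
    refine h2.trans_le ?_
    simp only [Pi.div_apply]
    rw [div_div_div_cancel_right₀ hk.ne']
    have h5 : s' / (k : ℝ) ^ r ≤ s / N := by
      rw [div_lt_div_iff₀ hk hs'0] at h3
      rw [div_le_div_iff₀ hk hN]
      nlinarith
    exact div_le_div₀ (h0 _ _) (hmono _ _ _ _ hfl h5) hN hNlt
  · obtain ⟨s', hs'1, hs'2⟩ := exists_between (show s < b / 2 by linarith)
    have hs'0 : 0 < s' := hs.trans hs'1
    have h1 := ((tendsto_add_atTop_iff_nat 1).2 (H s' hs'0)).mul hratio
    rw [mul_one] at h1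
    filter_upwards [hm.eventually (h1.eventually_lt_const (show 2 * s' < b by linarith)),
      hm.eventually (hratio.eventually_lt_const ((one_lt_div hs).2 hs'1)),
      hm.eventually (eventually_ge_atTop 1)] with N h2 h3 h4
    have hNle := hle N
    have hNlt := hlt N
    have hfl : N ≤ (Nat.nthRoot r N + 1) ^ r := (Nat.lt_pow_nthRoot_add_one hr N).le
    set k := Nat.nthRoot r N
    have hk : (0 : ℝ) < (k : ℝ) ^ r := by positivity
    have hN : (0 : ℝ) < N := hk.trans_le hNle
    have hk1 : (0 : ℝ) < ((k + 1 : ℕ) : ℝ) ^ r := by positivity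
    refine lt_of_le_of_lt ?_ h2
    rw [div_mul_div_cancel₀ hk1.ne']
    have h5 : s / N ≤ s' / ((k + 1 : ℕ) : ℝ) ^ r := by
      rw [div_lt_div_iff₀ hk hs] at h3
      rw [div_le_div_iff₀ hN hk1]
      nlinarith
    exact div_le_div₀ (h0 _ _) (hmono _ _ _ _ hfl h5) hk hNle

end

/-- For a sequence of distinct positive reals `a`, if the two Diophantine
counting conditions (A) and (B) hold for all small `ε > 0` with some fixed `δ > 0`, then
the pair correlation of `α·a(x)` is Poissonian for almost every `α`. -/
theorem pair_correlation_poissonian_of_counting_bounds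
    (a : ℕ → ℝ)
    (hpos : ∀ x : ℕ, 1 ≤ x → 0 < a x)
    (hdist : ∀ x y : ℕ, 1 ≤ x → 1 ≤ y → x ≠ y → a x ≠ a y)
    (δ ε₀ : ℝ) (hδ : 0 < δ) (hε₀ : 0 < ε₀)
    (hA : ∀ ε : ℝ, 0 < ε → ε < ε₀ → ∃ c : ℝ, 0 < c ∧ ∀ N : ℕ, 1 ≤ N →
      (countA a ((N : ℝ) ^ ((1 : ℝ) + ε)) ((N : ℝ) ^ ε) N : ℝ) ≤ c * (N : ℝ) ^ ((2 : ℝ) - δ))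
    (hB : ∀ ε : ℝ, 0 < ε → ε < ε₀ → ∃ c : ℝ, 0 < c ∧ ∀ N : ℕ, 1 ≤ N →
      (countB a ((N : ℝ) ^ ((1 : ℝ) + ε)) ((N : ℝ) ^ ε) N : ℝ) ≤ c * (N : ℝ) ^ ((4 : ℝ) - δ)) :
    ∀ᵐ α ∂(volume : Measure ℝ), ∀ s : ℝ, 0 < s →
      Tendsto (fun N : ℕ =>
          (Set.ncard {p : ℕ × ℕ | 1 ≤ p.1 ∧ p.1 ≤ N ∧ 1 ≤ p.2 ∧ p.2 ≤ N ∧ p.1 ≠ p.2 ∧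
            |α * a p.1 - α * a p.2 - (round (α * a p.1 - α * a p.2) : ℝ)| ≤ s / N} : ℝ)
            / (N : ℝ))
        atTop (nhds (2 * s)) := by
  obtain ⟨r, hr⟩ := exists_nat_gt (1 / δ)
  rw [div_lt_iff₀ hδ] at hr
  have hr0 : r ≠ 0 := by
    rintro rfl
    norm_num at hr
  have hε : 0 < ε₀ / 2 := half_pos hε₀
  obtain ⟨c, -, hc⟩ := hB (ε₀ / 2) hε (half_lt_self hε₀)
  let φ : ∀ p q : ℚ, 0 < p → p < q → ContDiffBump (0 : ℝ) := fun p q hp hpq =>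
    ⟨p, q, by exact_mod_cast hp, by exact_mod_cast hpq⟩
  have hu : Tendsto (fun k : ℕ => (k + 1) ^ r) atTop atTop :=
    (tendsto_pow_atTop hr0).comp (tendsto_add_atTop_nat 1)
  have hae : ∀ᵐ α ∂(volume : Measure ℝ), ∀ p q : ℚ, ∀ (hp : 0 < p) (hpq : p < q),
      Tendsto (fun k : ℕ => oscPart a (bumpSchwartz (φ p q hp hpq)) (ε₀ / 2) ((k + 1) ^ r) α) atTop
        (nhds 0) := by
    refine ae_all_iff.2 fun p => ae_all_iff.2 fun q => ae_all_iff.2 fun hp =>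
      ae_all_iff.2 fun hpq => ?_
    exact ae_tendsto_oscPart a _ hε hc hr
  filter_upwards [hae] with α hα s hs
  refine tendsto_div_of_tendsto_div_pow (c := fun N ρ => (pairCount a α N ρ : ℝ))
    (fun N ρ => Nat.cast_nonneg _)
    (fun M N ρ ρ' hMN hρ => Nat.cast_le.2 (pairCount_mono a α hMN hρ)) hr0 (fun s hs => ?_) hs
  rw [← tendsto_add_atTop_iff_nat 1]
  have h := tendsto_pairCount_of_contDiffBump a hu (fun p q hp hpq =>
    ⟨φ p q hp hpq, rfl, rfl, tendsto_sum_contDiffBump_div a _ hε hu (hα p q hp hpq)⟩) hs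
  simpa only [Nat.cast_pow] using h
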